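/- Let M ⊆ interior(N) be compact and let U ⊆ ℝ^d be an open set with M ⊆ U. Let F be a family of functions f : ℝ^d → ℝ, each bounded on N and three times continuously differentiable on U, such that for some B < ∞ one has sup_{f∈F} sup_{x∈N} |f(x)| ≤ B and sup_{f∈F} sup_{x∈U} |∂^α f(x)| ≤ B for every multi-index α with 1 ≤ |α| ≤ 3. Then there exist a constant C < ∞ and h₀ > 0 such that for all 0 < h < h₀, sup_{f∈F} sup_{p∈M} |Δ_h f(p) − (1/|N|) Δf(p)| ≤ C h. -/

import Mathlib

open MeasureTheory Real Filter
open scoped Topology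

/-- The Gaussian kernel `K(u) = (4π)^{-d/2} e^{-‖u‖²/4}` on `ℝ^d`. -/
noncomputable def gaussK (d : ℕ) (u : EuclideanSpace ℝ (Fin d)) : ℝ :=
  (4 * π) ^ (-(d : ℝ) / 2) * Real.exp (-‖u‖ ^ 2 / 4)

/-- The Euclidean Laplacian `Δf(p) = ∑ᵢ ∂²f/∂xᵢ²(p)`. -/
noncomputable def eucLap (d : ℕ) (f : EuclideanSpace ℝ (Fin d) → ℝ)
    (p : EuclideanSpace ℝ (Fin d)) : ℝ :=
  ∑ i : Fin d,
    iteratedFDeriv ℝ 2 f p ![EuclideanSpace.single i 1, EuclideanSpace.single i 1]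

/-- The averaging kernel operator
`Δ_h f(p) = h^{-(d+2)} E[K((p-X)/h)(f(X)-f(p))]`, where `X` is uniform on `N`. -/
noncomputable def avgLap (d : ℕ) (N : Set (EuclideanSpace ℝ (Fin d)))
    (f : EuclideanSpace ℝ (Fin d) → ℝ) (h : ℝ) (p : EuclideanSpace ℝ (Fin d)) : ℝ :=
  (h ^ (d + 2))⁻¹ * (((volume N).toReal)⁻¹ *
    ∫ x in N, gaussK d (h⁻¹ • (p - x)) * (f x - f p))

open ProbabilityTheory

section GaussianKernel

variable {d : ℕ}

lemma gaussK_nonneg (u : EuclideanSpace ℝ (Fin d)) : 0 ≤ gaussK d u := by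
  unfold gaussK; positivity

lemma gaussK_neg (u : EuclideanSpace ℝ (Fin d)) : gaussK d (-u) = gaussK d u := by
  simp [gaussK]

lemma continuous_gaussK : Continuous (gaussK d) := by
  unfold gaussK; fun_prop

lemma gaussK_eq_prod (u : EuclideanSpace ℝ (Fin d)) :
    gaussK d u = ∏ i, gaussianPDFReal 0 2 (u i) := by
  have h4 : (0 : ℝ) ≤ 4 * π := by positivity
  have hsqrt : (√(2 * π * 2))⁻¹ = (4 * π) ^ (-(1 / 2) : ℝ) := by
    rw [Real.rpow_neg h4, Real.sqrt_eq_rpow]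
    ring_nf
  simp only [gaussianPDFReal, gaussK, Finset.prod_mul_distrib, ← Real.exp_sum,
    EuclideanSpace.norm_sq_eq, NNReal.coe_ofNat, hsqrt, sub_zero, Finset.prod_const,
    Finset.card_univ, Fintype.card_fin, ← Real.rpow_mul_natCast h4, ← Finset.sum_div,
    Finset.sum_neg_distrib, Real.norm_eq_abs, sq_abs]
  ring_nf

lemma integral_gaussK_mul_prod (a : Fin d → ℝ → ℝ) :
    ∫ u, gaussK d u * ∏ i, a i (u i) = ∏ i, ∫ x, a i x ∂gaussianReal 0 2 := by
  have h2 : (2 : NNReal) ≠ 0 := two_ne_zero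
  simp_rw [integral_gaussianReal_eq_integral_smul h2, smul_eq_mul]
  rw [← integral_fintype_prod_volume_eq_prod (fun i x => gaussianPDFReal 0 2 x * a i x),
    ← (EuclideanSpace.volume_preserving_symm_measurableEquiv_toLp (Fin d)).integral_comp
      (MeasurableEquiv.measurableEmbedding _)]
  simp [gaussK_eq_prod, Finset.prod_mul_distrib]

lemma integral_sq_gaussianReal_zero_two : ∫ x, x * x ∂gaussianReal 0 2 = 2 := by
  have h := variance_eq_sub (memLp_id_gaussianReal (μ := 0) (v := 2) 2)
  rw [variance_id_gaussianReal] at h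
  simpa [integral_id_gaussianReal, pow_two] using h.symm

lemma integral_gaussK_mul_coord_mul_coord (i j : Fin d) :
    ∫ u, gaussK d u * (u i * u j) = if i = j then 2 else 0 := by
  have h := integral_gaussK_mul_prod (d := d)
    (fun k x => (if k = i then x else 1) * (if k = j then x else 1))
  simp only [Finset.prod_mul_distrib, Finset.prod_ite_eq', Finset.mem_univ, if_true] at h
  rw [h]
  split_ifs with hij
  · subst hij
    rw [Finset.prod_eq_single_of_mem i (Finset.mem_univ i)]
    · simpa using integral_sq_gaussianReal_zero_two
    · intro k _ hk
      simp [hk]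
  · apply Finset.prod_eq_zero (Finset.mem_univ i)
    simp [hij, integral_id_gaussianReal]

lemma integrable_gaussK_mul_norm_pow {k : ℕ} (hk : k ≤ 4) :
    Integrable (fun u : EuclideanSpace ℝ (Fin d) => gaussK d u * ‖u‖ ^ k) := by
  have hexp : Integrable (fun u : EuclideanSpace ℝ (Fin d) => Real.exp (-‖u‖ ^ 2 / 8)) := by
    have h := (GaussianFourier.integrable_cexp_neg_mul_sq_norm_add
      (V := EuclideanSpace ℝ (Fin d)) (b := 1 / 8) (by norm_num) 0 0).norm
    refine h.congr (Eventually.of_forall fun u => ?_)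
    simp only [Complex.norm_exp, zero_mul, add_zero]
    congr 1
    have : (-(1 / 8 : ℂ) * (‖u‖ : ℂ) ^ 2) = ((-‖u‖ ^ 2 / 8 : ℝ) : ℂ) := by
      push_cast; ring
    rw [this, Complex.ofReal_re]
  refine (hexp.const_mul ((4 * π) ^ (-(d : ℝ) / 2) * 129)).mono'
    (by have := continuous_gaussK (d := d); fun_prop) (Eventually.of_forall fun u => ?_)
  have hpow : ‖u‖ ^ k ≤ 1 + ‖u‖ ^ 4 := by
    rcases le_total ‖u‖ 1 with h1 | h1
    · have := pow_le_one₀ (n := k) (norm_nonneg u) h1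
      have : 0 ≤ ‖u‖ ^ 4 := by positivity
      linarith
    · have := pow_le_pow_right₀ h1 hk
      linarith
  have hs : 0 ≤ ‖u‖ ^ 2 / 8 := by positivity
  have h4 : ‖u‖ ^ 4 ≤ 128 * Real.exp (‖u‖ ^ 2 / 8) := by
    have h := Real.pow_div_factorial_le_exp _ hs 2
    norm_num [Nat.factorial] at h
    nlinarith
  have h0 : 1 ≤ Real.exp (‖u‖ ^ 2 / 8) := Real.one_le_exp hs
  have hsplit : Real.exp (-‖u‖ ^ 2 / 4) * Real.exp (‖u‖ ^ 2 / 8) = Real.exp (-‖u‖ ^ 2 / 8) := by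
    rw [← Real.exp_add]; ring_nf
  rw [norm_of_nonneg (mul_nonneg (gaussK_nonneg u) (by positivity)), gaussK, mul_assoc, mul_assoc]
  refine mul_le_mul_of_nonneg_left ?_ (by positivity)
  calc Real.exp (-‖u‖ ^ 2 / 4) * ‖u‖ ^ k
      ≤ Real.exp (-‖u‖ ^ 2 / 4) * (129 * Real.exp (‖u‖ ^ 2 / 8)) := by
        gcongr; linarith
    _ = 129 * Real.exp (-‖u‖ ^ 2 / 8) := by rw [← hsplit]; ring

lemma integrable_gaussK : Integrable (gaussK d) := by
  simpa using integrable_gaussK_mul_norm_pow (d := d) (k := 0) (by norm_num)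

lemma integral_gaussK_mul_linear (L : EuclideanSpace ℝ (Fin d) →L[ℝ] ℝ) :
    ∫ u, gaussK d u * L u = 0 := by
  have h := integral_neg_eq_self (fun u => gaussK d u * L u)
    (volume : Measure (EuclideanSpace ℝ (Fin d)))
  simp only [gaussK_neg, map_neg, mul_neg, integral_neg] at h
  linarith

lemma integrable_gaussK_mul_of_le {g : EuclideanSpace ℝ (Fin d) → ℝ}
    (hg : AEStronglyMeasurable g) {c : ℝ} {k : ℕ} (hk : k ≤ 4)
    (hle : ∀ u, |g u| ≤ c * ‖u‖ ^ k) : Integrable (fun u => gaussK d u * g u) := by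
  refine ((integrable_gaussK_mul_norm_pow hk).const_mul c).mono'
    (continuous_gaussK.aestronglyMeasurable.mul hg) (Eventually.of_forall fun u => ?_)
  rw [norm_mul, norm_of_nonneg (gaussK_nonneg u), Real.norm_eq_abs]
  calc gaussK d u * |g u| ≤ gaussK d u * (c * ‖u‖ ^ k) :=
        mul_le_mul_of_nonneg_left (hle u) (gaussK_nonneg u)
    _ = c * (gaussK d u * ‖u‖ ^ k) := by ring

lemma ContinuousMultilinearMap.apply_diag_eq_sum
    (A : ContinuousMultilinearMap ℝ (fun _ : Fin 2 => EuclideanSpace ℝ (Fin d)) ℝ)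
    (u : EuclideanSpace ℝ (Fin d)) :
    A (fun _ => u) = ∑ i, ∑ j,
      (u i * u j) * A ![EuclideanSpace.single i 1, EuclideanSpace.single j 1] := by
  have hu : u = ∑ i, u i • EuclideanSpace.single i (1 : ℝ) := by
    ext j
    simp [Finset.sum_apply, Pi.single_apply]
  conv_lhs => rw [hu]
  rw [ContinuousMultilinearMap.map_sum, ← Fintype.sum_prod_type',
    ← (finTwoArrowEquiv (Fin d)).sum_comp]
  refine Finset.sum_congr rfl fun r _ => ?_
  rw [ContinuousMultilinearMap.map_smul_univ A (fun k => u (r k))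
    (fun k => EuclideanSpace.single (r k) (1 : ℝ))]
  simp only [Fin.prod_univ_two, smul_eq_mul, finTwoArrowEquiv_apply]
  congr 2
  ext k
  fin_cases k <;> rfl

lemma integral_gaussK_mul_quadratic
    (A : ContinuousMultilinearMap ℝ (fun _ : Fin 2 => EuclideanSpace ℝ (Fin d)) ℝ) :
    ∫ u, gaussK d u * A (fun _ => u) =
      2 * ∑ i, A ![EuclideanSpace.single i 1, EuclideanSpace.single i 1] := by
  have hInt (i j : Fin d) : Integrable (fun u : EuclideanSpace ℝ (Fin d) =>
      gaussK d u * (u i * u j)) := by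
    refine integrable_gaussK_mul_of_le (c := 1) (k := 2) (by fun_prop) (by norm_num) fun u => ?_
    rw [abs_mul, one_mul, pow_two]
    exact mul_le_mul (PiLp.norm_apply_le u i) (PiLp.norm_apply_le u j) (abs_nonneg _)
      (norm_nonneg _)
  have hexpand (u : EuclideanSpace ℝ (Fin d)) : gaussK d u * A (fun _ => u) = ∑ i, ∑ j,
      gaussK d u * (u i * u j) * A ![EuclideanSpace.single i 1, EuclideanSpace.single j 1] := by
    simp_rw [A.apply_diag_eq_sum, Finset.mul_sum, mul_assoc]
  simp_rw [hexpand, Finset.mul_sum]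
  rw [integral_finsetSum _ fun i _ => integrable_finsetSum _ fun j _ => (hInt i j).mul_const _]
  refine Finset.sum_congr rfl fun i _ => ?_
  rw [integral_finsetSum _ fun j _ => (hInt i j).mul_const _]
  simp_rw [integral_mul_const, integral_gaussK_mul_coord_mul_coord]
  simp

lemma integral_comp_inv_smul_sub (φ : EuclideanSpace ℝ (Fin d) → ℝ)
    (p : EuclideanSpace ℝ (Fin d)) {h : ℝ} (hh : 0 ≤ h) :
    ∫ x, φ (h⁻¹ • (p - x)) = h ^ d * ∫ u, φ u := by
  rw [integral_sub_left_eq_self (fun y => φ (h⁻¹ • y)) volume p,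
    Measure.integral_comp_inv_smul_of_nonneg _ _ hh]
  simp

lemma MeasureTheory.Integrable.comp_inv_smul_sub {φ : EuclideanSpace ℝ (Fin d) → ℝ}
    (hφ : Integrable φ) (p : EuclideanSpace ℝ (Fin d)) {h : ℝ} (hh : h ≠ 0) :
    Integrable (fun x => φ (h⁻¹ • (p - x))) :=
  ((integrable_comp_smul_iff volume φ (inv_ne_zero hh)).2 hφ).comp_sub_left p

/-- Convolving with the scaled Gaussian kernel a function that agrees with a quadratic
polynomial up to a cubic error. -/
lemma abs_integral_gaussK_sub_le {G : EuclideanSpace ℝ (Fin d) → ℝ} (hG : AEStronglyMeasurable G)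
    {b : ℝ} (hGb : ∀ x, |G x| ≤ b) (p : EuclideanSpace ℝ (Fin d))
    (L : EuclideanSpace ℝ (Fin d) →L[ℝ] ℝ)
    (A : ContinuousMultilinearMap ℝ (fun _ : Fin 2 => EuclideanSpace ℝ (Fin d)) ℝ) {c : ℝ}
    (hc : ∀ v, |G (p + v) - (L v + A (fun _ => v) / 2)| ≤ c * ‖v‖ ^ 3) {h : ℝ} (hh : 0 < h) :
    |(h ^ (d + 2))⁻¹ * (∫ x, gaussK d (h⁻¹ • (p - x)) * G x) -
        ∑ i, A ![EuclideanSpace.single i 1, EuclideanSpace.single i 1]| ≤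
      c * (∫ u : EuclideanSpace ℝ (Fin d), gaussK d u * ‖u‖ ^ 3) * h := by
  have hL : Integrable (fun u => gaussK d u * L u) :=
    integrable_gaussK_mul_of_le (c := ‖L‖) (k := 1) (by fun_prop) (by norm_num)
      fun u => by simpa using L.le_opNorm u
  have hA : Integrable (fun u => gaussK d u * A (fun _ => u)) :=
    integrable_gaussK_mul_of_le (c := ‖A‖) (k := 2)
      (Continuous.aestronglyMeasurable (by fun_prop)) (by norm_num)
      fun u => by simpa using A.le_opNorm (fun _ => u)
  set Q : EuclideanSpace ℝ (Fin d) → ℝ := fun u =>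
    gaussK d u * (-h * L u) + gaussK d u * (h ^ 2 / 2 * A (fun _ => u)) with hQ
  have hQ1 : Integrable (fun u => gaussK d u * (-h * L u)) :=
    (hL.const_mul (-h)).congr (Eventually.of_forall fun u => by ring)
  have hQ2 : Integrable (fun u => gaussK d u * (h ^ 2 / 2 * A (fun _ => u))) :=
    (hA.const_mul (h ^ 2 / 2)).congr (Eventually.of_forall fun u => by ring)
  have hQint : ∫ u, Q u =
      h ^ 2 * ∑ i, A ![EuclideanSpace.single i 1, EuclideanSpace.single i 1] := by
    rw [hQ, integral_add hQ1 hQ2]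
    simp_rw [mul_left_comm (gaussK d _), integral_const_mul]
    rw [integral_gaussK_mul_linear, integral_gaussK_mul_quadratic]
    ring
  have hQi : Integrable Q := hQ1.add hQ2
  have hGi : Integrable (fun x => gaussK d (h⁻¹ • (p - x)) * G x) :=
    (integrable_gaussK.comp_inv_smul_sub p hh.ne').mul_bdd hG
      (Eventually.of_forall fun x => hGb x)
  have hdiff : |(∫ x, gaussK d (h⁻¹ • (p - x)) * G x) - ∫ x, Q (h⁻¹ • (p - x))| ≤
      ∫ x, c * h ^ 3 * (gaussK d (h⁻¹ • (p - x)) * ‖h⁻¹ • (p - x)‖ ^ 3) := by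
    rw [← integral_sub hGi (hQi.comp_inv_smul_sub p hh.ne')]
    have h3 : Integrable (fun u : EuclideanSpace ℝ (Fin d) => gaussK d u * ‖u‖ ^ 3) :=
      integrable_gaussK_mul_norm_pow (by norm_num)
    rw [← Real.norm_eq_abs]
    refine norm_integral_le_of_norm_le ((h3.comp_inv_smul_sub p hh.ne').const_mul (c * h ^ 3))
      (Eventually.of_forall fun x => ?_)
    obtain ⟨u, rfl⟩ : ∃ u : EuclideanSpace ℝ (Fin d), x = p + (-h) • u := ⟨h⁻¹ • (p - x), by
      rw [smul_smul, neg_mul, mul_inv_cancel₀ hh.ne']; simp⟩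
    have hu : h⁻¹ • (p - (p + (-h) • u)) = u := by
      rw [sub_add_cancel_left, neg_smul, neg_neg, smul_smul, inv_mul_cancel₀ hh.ne', one_smul]
    have hAh : A (fun _ => (-h) • u) = h ^ 2 * A (fun _ => u) := by
      rw [A.map_smul_univ (fun _ => -h) (fun _ => u)]
      simp
    have hcu := hc ((-h) • u)
    rw [hAh, map_smul, norm_smul, norm_neg, norm_of_nonneg hh.le, smul_eq_mul] at hcu
    rw [hu, hQ, Real.norm_eq_abs]
    have : gaussK d u * G (p + (-h) • u) -
        (gaussK d u * (-h * L u) + gaussK d u * (h ^ 2 / 2 * A (fun _ => u))) =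
        gaussK d u * (G (p + (-h) • u) - (-h * L u + h ^ 2 * A (fun _ => u) / 2)) := by ring
    simp only [this]
    rw [abs_mul, abs_of_nonneg (gaussK_nonneg u)]
    calc _ ≤ gaussK d u * (c * (h * ‖u‖) ^ 3) :=
          mul_le_mul_of_nonneg_left hcu (gaussK_nonneg u)
      _ = _ := by ring
  rw [integral_const_mul, integral_comp_inv_smul_sub _ p hh.le,
    integral_comp_inv_smul_sub (fun u => gaussK d u * ‖u‖ ^ 3) p hh.le, hQint] at hdiff
  have hpos : 0 < h ^ (d + 2) := by positivity
  set I := ∫ x, gaussK d (h⁻¹ • (p - x)) * G x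
  set S := ∑ i, A ![EuclideanSpace.single i 1, EuclideanSpace.single i 1]
  have : (h ^ (d + 2))⁻¹ * I - S = (h ^ (d + 2))⁻¹ * (I - h ^ d * (h ^ 2 * S)) := by
    field_simp
    ring
  rw [this, abs_mul, abs_of_pos (inv_pos.2 hpos), inv_mul_le_iff₀ hpos]
  calc _ ≤ _ := hdiff
    _ = _ := by ring

end GaussianKernel

section Taylor

variable {E : Type*} [NormedAddCommGroup E] [NormedSpace ℝ E] {f : E → ℝ}

lemma hasDerivAt_iteratedFDeriv_line {k : ℕ} {n : WithTop ℕ∞} (hk : (k : WithTop ℕ∞) < n)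
    (p v : E) {t : ℝ} (hf : ContDiffAt ℝ n f (p + t • v)) :
    HasDerivAt (fun s : ℝ => iteratedFDeriv ℝ k f (p + s • v) (fun _ => v))
      (iteratedFDeriv ℝ (k + 1) f (p + t • v) (fun _ => v)) t := by
  have hline : HasDerivAt (fun s : ℝ => p + s • v) v t := by
    simpa using ((hasDerivAt_id t).smul_const v).const_add p
  have h1 := (hf.differentiableAt_iteratedFDeriv hk).hasFDerivAt.comp_hasDerivAt t hline
  have h2 := (ContinuousMultilinearMap.apply ℝ (fun _ : Fin k => E) ℝ
    (fun _ => v)).hasFDerivAt.comp_hasDerivAt t h1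
  rw [iteratedFDeriv_succ_apply_left]
  exact h2

/-- Second order Taylor expansion with a (non-sharp) cubic bound on the remainder. -/
lemma abs_sub_taylor_two_le {U : Set E} (hU : IsOpen U) (hf : ContDiffOn ℝ 3 f U) {B : ℝ}
    (hB : ∀ x ∈ U, ‖iteratedFDeriv ℝ 3 f x‖ ≤ B) {p v : E}
    (hseg : ∀ t ∈ Set.Icc (0 : ℝ) 1, p + t • v ∈ U) :
    |f (p + v) - f p - (fderiv ℝ f p v + iteratedFDeriv ℝ 2 f p (fun _ => v) / 2)| ≤
      B * ‖v‖ ^ 3 := by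
  set φ : ℕ → ℝ → ℝ := fun k t => iteratedFDeriv ℝ k f (p + t • v) (fun _ => v) with hφ
  have hd (k : ℕ) (hk : (k : WithTop ℕ∞) < 3) (t : ℝ) (ht : t ∈ Set.Icc (0 : ℝ) 1) :
      HasDerivAt (φ k) (φ (k + 1) t) t :=
    hasDerivAt_iteratedFDeriv_line hk p v (hf.contDiffAt (hU.mem_nhds (hseg t ht)))
  have mvt (g g' : ℝ → ℝ) (hg : ∀ t ∈ Set.Icc (0 : ℝ) 1, HasDerivAt g (g' t) t) (h0 : g 0 = 0)
      (hg' : ∀ t ∈ Set.Icc (0 : ℝ) 1, |g' t| ≤ B * ‖v‖ ^ 3) :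
      ∀ t ∈ Set.Icc (0 : ℝ) 1, |g t| ≤ B * ‖v‖ ^ 3 := by
    intro t ht
    have h := norm_image_sub_le_of_norm_deriv_le_segment' (a := 0) (b := 1) (f := g) (f' := g')
      (fun s hs => (hg s hs).hasDerivWithinAt) (fun s hs => hg' s ⟨hs.1, hs.2.le⟩) t ht
    rw [h0, sub_zero, sub_zero, Real.norm_eq_abs] at h
    have hnn : 0 ≤ B * ‖v‖ ^ 3 := (abs_nonneg _).trans (hg' t ht)
    nlinarith [ht.2]
  have h3 : ∀ t ∈ Set.Icc (0 : ℝ) 1, |φ 3 t| ≤ B * ‖v‖ ^ 3 := by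
    intro t ht
    have h := (iteratedFDeriv ℝ 3 f (p + t • v)).le_opNorm (fun _ => v)
    simp only [Finset.prod_const, Finset.card_univ, Fintype.card_fin] at h
    exact h.trans (by gcongr; exact hB _ (hseg t ht))
  have h2 := mvt (fun t => φ 2 t - φ 2 0) (φ 3)
    (fun t ht => (hd 2 (by norm_num) t ht).sub_const _) (by simp) h3
  have h1 := mvt (fun t => φ 1 t - φ 1 0 - t * φ 2 0) (fun t => φ 2 t - φ 2 0)
    (fun t ht => by
      simpa using ((hd 1 (by norm_num) t ht).sub_const (φ 1 0)).fun_sub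
        ((hasDerivAt_id t).mul_const (φ 2 0))) (by simp) h2
  have h0 := mvt (fun t => φ 0 t - φ 0 0 - t * φ 1 0 - t ^ 2 / 2 * φ 2 0)
    (fun t => φ 1 t - φ 1 0 - t * φ 2 0)
    (fun t ht => by
      have hsq : HasDerivAt (fun t : ℝ => t ^ 2 / 2) t t := by
        simpa using (hasDerivAt_pow 2 t).div_const 2
      simpa using (((hd 0 (by norm_num) t ht).sub_const (φ 0 0)).fun_sub
        ((hasDerivAt_id t).mul_const (φ 1 0))).fun_sub (hsq.mul_const (φ 2 0)))
    (by simp) h1 1 (by simp)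
  have e1 : φ 1 0 = fderiv ℝ f p v := by simp [hφ, iteratedFDeriv_one_apply]
  have e2 : φ 2 0 = iteratedFDeriv ℝ 2 f p (fun _ => v) := by simp [hφ]
  have e0 : φ 0 0 = f p := by simp [hφ]
  have e01 : φ 0 1 = f (p + v) := by simp [hφ]
  simp only [e0, e01, e1, e2] at h0
  convert h0 using 2
  ring

end Taylor


theorem stmt1 (d : ℕ) (hd : 1 ≤ d) (N : Set (EuclideanSpace ℝ (Fin d)))
    (hNcomp : IsCompact N) (hNpos : 0 < volume N)
    (M : Set (EuclideanSpace ℝ (Fin d))) (hMcomp : IsCompact M)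
    (hMint : M ⊆ interior N)
    (U : Set (EuclideanSpace ℝ (Fin d))) (hU : IsOpen U) (hMU : M ⊆ U)
    (F : Set (EuclideanSpace ℝ (Fin d) → ℝ)) (B : ℝ)
    (hFsm : ∀ f ∈ F, ContDiffOn ℝ 3 f U)
    (hFmeas : ∀ f ∈ F, AEMeasurable f (volume.restrict N))
    (hFbdd : ∀ f ∈ F, ∀ x ∈ N, |f x| ≤ B)
    (hFder : ∀ f ∈ F, ∀ x ∈ U, ∀ k : ℕ, 1 ≤ k → k ≤ 3 →
      ‖iteratedFDeriv ℝ k f x‖ ≤ B) :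
    ∃ C : ℝ, ∃ h₀ : ℝ, 0 < h₀ ∧ ∀ h : ℝ, 0 < h → h < h₀ → ∀ f ∈ F, ∀ p ∈ M,
      |avgLap d N f h p - ((volume N).toReal)⁻¹ * eucLap d f p| ≤ C * h := by
  obtain ⟨δ, hδ, hδsub⟩ := hMcomp.exists_cthickening_subset_open
    (isOpen_interior.inter hU) (Set.subset_inter hMint hMU)
  set c : ℝ := B + 2 * B / δ ^ 3 + B / δ ^ 2 + B / δ with hc
  refine ⟨(volume N).toReal⁻¹ *
    (c * ∫ u : EuclideanSpace ℝ (Fin d), gaussK d u * ‖u‖ ^ 3), 1, one_pos, ?_⟩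
  intro h hh _ f hf p hp
  have hmem (v : EuclideanSpace ℝ (Fin d)) (hv : ‖v‖ ≤ δ) : p + v ∈ interior N ∩ U :=
    hδsub (Metric.mem_cthickening_of_dist_le _ p _ _ hp (by simpa using hv))
  have hpN : p ∈ N := interior_subset (hMint hp)
  have hB0 : 0 ≤ B := (abs_nonneg _).trans (hFbdd f hf p hpN)
  set G : EuclideanSpace ℝ (Fin d) → ℝ := N.indicator fun x => f x - f p with hG
  have hGm : AEStronglyMeasurable G := by
    rw [hG, aestronglyMeasurable_indicator_iff hNcomp.measurableSet]
    exact ((hFmeas f hf).sub_const _).aestronglyMeasurable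
  have hGb (x) : |G x| ≤ 2 * B := by
    by_cases hx : x ∈ N
    · rw [hG, Set.indicator_of_mem hx]
      calc _ ≤ |f x| + |f p| := abs_sub _ _
        _ ≤ 2 * B := by linarith [hFbdd f hf x hx, hFbdd f hf p hpN]
    · rw [hG, Set.indicator_of_notMem hx, abs_zero]
      positivity
  have hrem (v : EuclideanSpace ℝ (Fin d)) :
      |G (p + v) - (fderiv ℝ f p v + iteratedFDeriv ℝ 2 f p (fun _ => v) / 2)| ≤
        c * ‖v‖ ^ 3 := by
    rcases le_or_gt ‖v‖ δ with hv | hv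
    · rw [hG, Set.indicator_of_mem (interior_subset (hmem v hv).1)]
      refine (abs_sub_taylor_two_le hU (hFsm f hf)
        (fun x hx => hFder f hf x hx 3 (by norm_num) le_rfl) fun t ht => (hmem _ ?_).2).trans ?_
      · rw [norm_smul, norm_of_nonneg ht.1]
        exact (mul_le_of_le_one_left (norm_nonneg v) ht.2).trans hv
      · gcongr
        have : 0 ≤ 2 * B / δ ^ 3 + B / δ ^ 2 + B / δ := by positivity
        rw [hc]; linarith
    · have hD1 : |fderiv ℝ f p v| ≤ B * ‖v‖ := by
        refine ((fderiv ℝ f p).le_opNorm v).trans ?_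
        gcongr
        simpa [norm_iteratedFDeriv_one] using hFder f hf p (hMU hp) 1 le_rfl (by norm_num)
      have hD2 : |iteratedFDeriv ℝ 2 f p (fun _ => v)| ≤ B * ‖v‖ ^ 2 := by
        have := (iteratedFDeriv ℝ 2 f p).le_opNorm (fun _ => v)
        simp only [Finset.prod_const, Finset.card_univ, Fintype.card_fin] at this
        refine this.trans ?_
        gcongr
        exact hFder f hf p (hMU hp) 2 (by norm_num) (by norm_num)
      have hr : 1 ≤ ‖v‖ / δ := (one_le_div hδ).2 hv.le
      have hr3 : 2 * B ≤ 2 * B / δ ^ 3 * ‖v‖ ^ 3 := by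
        calc 2 * B ≤ 2 * B * (‖v‖ / δ) ^ 3 :=
              le_mul_of_one_le_right (by positivity) (one_le_pow₀ hr)
          _ = _ := by field_simp
      have hr2 : B * ‖v‖ ≤ B / δ ^ 2 * ‖v‖ ^ 3 := by
        calc B * ‖v‖ ≤ B * ‖v‖ * (‖v‖ / δ) ^ 2 :=
              le_mul_of_one_le_right (by positivity) (one_le_pow₀ hr)
          _ = _ := by field_simp
      have hr1 : B * ‖v‖ ^ 2 ≤ B / δ * ‖v‖ ^ 3 := by
        calc B * ‖v‖ ^ 2 ≤ B * ‖v‖ ^ 2 * (‖v‖ / δ) :=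
              le_mul_of_one_le_right (by positivity) hr
          _ = _ := by field_simp
      have hr0 : 0 ≤ B * ‖v‖ ^ 3 := by positivity
      have hsum : c * ‖v‖ ^ 3 = B * ‖v‖ ^ 3 + 2 * B / δ ^ 3 * ‖v‖ ^ 3 +
          B / δ ^ 2 * ‖v‖ ^ 3 + B / δ * ‖v‖ ^ 3 := by rw [hc]; ring
      have hGv := hGb (p + v)
      have hq : 0 ≤ B * ‖v‖ ^ 2 := by positivity
      rw [hsum, abs_le]
      rw [abs_le] at hGv hD1 hD2
      constructor <;> linarith [hGv.1, hGv.2, hD1.1, hD1.2, hD2.1, hD2.2]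
  have hmain := abs_integral_gaussK_sub_le hGm hGb p (fderiv ℝ f p) (iteratedFDeriv ℝ 2 f p)
    hrem hh
  have hInt : ∫ x in N, gaussK d (h⁻¹ • (p - x)) * (f x - f p) =
      ∫ x, gaussK d (h⁻¹ • (p - x)) * G x := by
    rw [← integral_indicator hNcomp.measurableSet]
    simp only [hG, Set.indicator_mul_right]
  rw [avgLap, eucLap, hInt, mul_left_comm, ← mul_sub, abs_mul,
    abs_of_nonneg (inv_nonneg.2 ENNReal.toReal_nonneg), mul_assoc]
  exact mul_le_mul_of_nonneg_left hmain (inv_nonneg.2 ENNReal.toReal_nonneg)
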